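/- arXiv:2205.02949 — 4 statements merged into one kernel-verified Lean document; each statement's English description precedes it below -/
import Mathlib

section
/- Let E be a real inner product space, let v_1, ..., v_N be vectors in E, and let S ⊆ {1,...,N} be a subset of 'Byzantine' indices with |S| = B and 2B < N. Set R = N - B, α = B/N and C_α = (2-2α)/(1-2α). If z ∈ E is a geometric median of {v_1,...,v_N}, i.e. z minimizes the function w ↦ ∑_{i=1}^N ‖w - v_i‖ over E, then ‖z‖ ≤ (C_α / R) · ∑_{i ∉ S} ‖v_i‖. -/
open Finset

/-- Deterministic core of Lemma 2: geometric-median robustness bound (first moment). -/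
theorem stmt_0 {E : Type*} [NormedAddCommGroup E] [InnerProductSpace ℝ E]
    (N B : ℕ) (v : Fin N → E) (S : Finset (Fin N))
    (hScard : S.card = B) (hB : 2 * B < N) (z : E)
    (hz : ∀ w : E, ∑ i, ‖z - v i‖ ≤ ∑ i, ‖w - v i‖) :
    ‖z‖ ≤ ((2 - 2 * ((B : ℝ) / N)) / (1 - 2 * ((B : ℝ) / N)) / ((N : ℝ) - B)) *
      ∑ i ∈ Sᶜ, ‖v i‖ := by
  have h0 := hz 0
  rw [← Finset.sum_add_sum_compl S, ← Finset.sum_add_sum_compl S (fun i => ‖0 - v i‖)] at h0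
  simp only [zero_sub, norm_neg] at h0
  have h1 : ∑ i ∈ S, (‖v i‖ - ‖z‖) ≤ ∑ i ∈ S, ‖z - v i‖ := by
    apply Finset.sum_le_sum
    intro i _
    rw [norm_sub_rev]
    exact norm_sub_norm_le _ _
  have h2 : ∑ i ∈ Sᶜ, (‖z‖ - ‖v i‖) ≤ ∑ i ∈ Sᶜ, ‖z - v i‖ := by
    apply Finset.sum_le_sum
    intro i _
    exact norm_sub_norm_le _ _
  have hc : ((Sᶜ.card : ℕ) : ℝ) = (N : ℝ) - B := by
    rw [Finset.card_compl, Fintype.card_fin, hScard, Nat.cast_sub (by omega)]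
  rw [Finset.sum_sub_distrib, Finset.sum_const, nsmul_eq_mul, hScard] at h1
  rw [Finset.sum_sub_distrib, Finset.sum_const, nsmul_eq_mul, hc] at h2
  have hB' : 2 * (B : ℝ) < N := by exact_mod_cast hB
  have hB0 : (0 : ℝ) ≤ B := Nat.cast_nonneg B
  have hN : (N : ℝ) ≠ 0 := by linarith
  have hNB : (N : ℝ) - B ≠ 0 := by linarith
  have hN2 : (0 : ℝ) < N - 2 * B := by linarith
  have e1 : 2 - 2 * ((B : ℝ) / N) = 2 * (N - B) / N := by field_simp
  have e2 : 1 - 2 * ((B : ℝ) / N) = (N - 2 * B) / N := by field_simp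
  have hcoef : ((2 - 2 * ((B : ℝ) / N)) / (1 - 2 * ((B : ℝ) / N)) / ((N : ℝ) - B))
      = 2 / (N - 2 * B) := by
    rw [e1, e2]
    have := hN2.ne'
    field_simp
  rw [hcoef, div_mul_eq_mul_div, le_div_iff₀ hN2]
  linarith
end

section
/- Let E be a real inner product space, let v_1, ..., v_N be vectors in E, and let S ⊆ {1,...,N} with |S| = B and 2B < N. Set R = N - B, α = B/N and C_α = (2-2α)/(1-2α). If z ∈ E minimizes w ↦ ∑_{i=1}^N ‖w - v_i‖ over E, then ‖z‖² ≤ (C_α² / R) · ∑_{i ∉ S} ‖v_i‖². -/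
open Finset

/-- Deterministic form of Lemma 2: squared-norm geometric-median robustness bound. -/
theorem stmt_1 {E : Type*} [NormedAddCommGroup E] [InnerProductSpace ℝ E]
    (N B : ℕ) (v : Fin N → E) (S : Finset (Fin N))
    (hScard : S.card = B) (hB : 2 * B < N) (z : E)
    (hz : ∀ w : E, ∑ i, ‖z - v i‖ ≤ ∑ i, ‖w - v i‖) :
    ‖z‖ ^ 2 ≤ (((2 - 2 * ((B : ℝ) / N)) / (1 - 2 * ((B : ℝ) / N))) ^ 2 / ((N : ℝ) - B)) *
      ∑ i ∈ Sᶜ, ‖v i‖ ^ 2 := by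
  have h0 := hz 0
  simp only [zero_sub, norm_neg] at h0
  rw [← Finset.sum_add_sum_compl S, ← Finset.sum_add_sum_compl S (fun i => ‖v i‖)] at h0
  have h1 : ∑ i ∈ S, (‖v i‖ - ‖z‖) ≤ ∑ i ∈ S, ‖z - v i‖ :=
    Finset.sum_le_sum fun i _ => by
      rw [norm_sub_rev]; exact norm_sub_norm_le _ _
  have h2 : ∑ i ∈ Sᶜ, (‖z‖ - ‖v i‖) ≤ ∑ i ∈ Sᶜ, ‖z - v i‖ :=
    Finset.sum_le_sum fun i _ => norm_sub_norm_le _ _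
  have hc : ((Sᶜ.card : ℕ) : ℝ) = (N : ℝ) - B := by
    rw [Finset.card_compl, Fintype.card_fin, hScard, Nat.cast_sub (by omega)]
  have hcs := sq_sum_le_card_mul_sum_sq (s := Sᶜ) (f := fun i => ‖v i‖)
  rw [Finset.sum_sub_distrib, Finset.sum_const, nsmul_eq_mul] at h1 h2
  rw [hc] at h2 hcs
  rw [hScard] at h1
  have hB' : 2 * (B : ℝ) < N := by exact_mod_cast hB
  have hB0 : (0 : ℝ) ≤ B := Nat.cast_nonneg B
  have hN : (0 : ℝ) < N := by linarith
  have hR : (0 : ℝ) < (N : ℝ) - B := by linarith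
  have hD : (0 : ℝ) < (N : ℝ) - 2 * B := by linarith
  have h3 : ((N : ℝ) - 2 * B) * ‖z‖ ≤ 2 * ∑ i ∈ Sᶜ, ‖v i‖ := by linarith
  have h4 := pow_le_pow_left₀ (mul_nonneg hD.le (norm_nonneg z)) h3 2
  have hC : ((2 - 2 * ((B : ℝ) / N)) / (1 - 2 * ((B : ℝ) / N))) ^ 2 / ((N : ℝ) - B)
      = 4 * ((N : ℝ) - B) / ((N : ℝ) - 2 * B) ^ 2 := by
    have e1 : 2 - 2 * ((B : ℝ) / N) = 2 * ((N : ℝ) - B) / N := by field_simp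
    have e2 : 1 - 2 * ((B : ℝ) / N) = ((N : ℝ) - 2 * B) / N := by field_simp
    rw [e1, e2, div_div_div_cancel_right₀ hN.ne']
    have := hR.ne'
    have := hD.ne'
    field_simp
    ring
  rw [hC, div_mul_eq_mul_div, le_div_iff₀ (by positivity)]
  nlinarith [h4, hcs]
end

section
/- Let E be a real inner product space, let v_1, ..., v_N be vectors in E, and let S ⊆ {1,...,N} with |S| = B and 2B < N. Set R = N - B, α = B/N and C_α = (2-2α)/(1-2α). If z ∈ E minimizes w ↦ ∑_{i=1}^N ‖w - v_i‖ over E, then for every point c ∈ E, ‖z - c‖ ≤ (C_α / R) · ∑_{i ∉ S} ‖v_i - c‖. -/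
open Finset

/-- Translated geometric-median robustness bound (underlies Lemma 1). -/
theorem stmt_2 {E : Type*} [NormedAddCommGroup E] [InnerProductSpace ℝ E]
    (N B : ℕ) (v : Fin N → E) (S : Finset (Fin N))
    (hScard : S.card = B) (hB : 2 * B < N) (z : E)
    (hz : ∀ w : E, ∑ i, ‖z - v i‖ ≤ ∑ i, ‖w - v i‖) :
    ∀ c : E, ‖z - c‖ ≤ ((2 - 2 * ((B : ℝ) / N)) / (1 - 2 * ((B : ℝ) / N)) / ((N : ℝ) - B)) *
      ∑ i ∈ Sᶜ, ‖v i - c‖ := by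
  intro c
  have h := hz c
  rw [← Finset.sum_add_sum_compl S, ← Finset.sum_add_sum_compl S (fun i => ‖c - v i‖)] at h
  have hBN : (2 : ℝ) * B < N := by exact_mod_cast hB
  have hB0 : (0 : ℝ) ≤ B := Nat.cast_nonneg B
  have hcc : ((Sᶜ).card : ℝ) = N - B := by
    rw [Finset.card_compl, Fintype.card_fin, hScard, Nat.cast_sub (by omega)]
  have h1 : ∑ i ∈ S, (‖c - v i‖ - ‖z - c‖) ≤ ∑ i ∈ S, ‖z - v i‖ := by
    refine Finset.sum_le_sum fun i _ => ?_
    have := norm_sub_le_norm_sub_add_norm_sub c z (v i)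
    rw [norm_sub_rev c z] at this
    linarith
  have h2 : ∑ i ∈ Sᶜ, (‖z - c‖ - ‖v i - c‖) ≤ ∑ i ∈ Sᶜ, ‖z - v i‖ := by
    refine Finset.sum_le_sum fun i _ => ?_
    have := norm_sub_le_norm_sub_add_norm_sub z (v i) c
    linarith
  have h3 : ∑ i ∈ Sᶜ, ‖c - v i‖ = ∑ i ∈ Sᶜ, ‖v i - c‖ :=
    Finset.sum_congr rfl fun i _ => norm_sub_rev _ _
  rw [Finset.sum_sub_distrib, Finset.sum_const, nsmul_eq_mul, hScard] at h1
  rw [Finset.sum_sub_distrib, Finset.sum_const, nsmul_eq_mul, hcc] at h2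
  have hN : (N : ℝ) ≠ 0 := by linarith
  have e1 : (1 : ℝ) - 2 * ((B : ℝ) / N) = (N - 2 * B) / N := by field_simp
  have e2 : (2 : ℝ) - 2 * ((B : ℝ) / N) = 2 * (N - B) / N := by field_simp
  have hp : (0 : ℝ) < N - 2 * B := by linarith
  have hq : (N : ℝ) - B ≠ 0 := by linarith
  have e : (2 - 2 * ((B : ℝ) / N)) / (1 - 2 * ((B : ℝ) / N)) / ((N : ℝ) - B)
      = 2 / (N - 2 * B) := by
    rw [e1, e2]
    have := hp.ne'
    field_simp
  rw [e, div_mul_eq_mul_div, le_div_iff₀ hp]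
  linarith
end

section
/- Let s and G be integers with s ≥ 2 and G ≥ 2, and set d = (G - 1)/(sG - 1). Then there exists α₀ with 0 < α₀ < 1/(2s) such that for every real α with 0 ≤ α ≤ α₀: ((2 - 2sα)/(1 - 2sα))² · d ≤ ((2 - 2α)/(1 - 2α))². -/
/-- For `s > 1` the coefficient `C_{sα}² d` is smaller than `C_α²` when the Byzantine
fraction `α` is sufficiently small. -/
theorem stmt_18 (s G : ℕ) (hs : 2 ≤ s) (hG : 2 ≤ G) :
    ∃ α₀ : ℝ, 0 < α₀ ∧ α₀ < 1 / (2 * (s : ℝ)) ∧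
      ∀ α : ℝ, 0 ≤ α → α ≤ α₀ →
        ((2 - 2 * (s : ℝ) * α) / (1 - 2 * (s : ℝ) * α)) ^ 2 *
            (((G : ℝ) - 1) / ((s : ℝ) * (G : ℝ) - 1)) ≤
          ((2 - 2 * α) / (1 - 2 * α)) ^ 2 := by
  have hs' : (2 : ℝ) ≤ s := by exact_mod_cast hs
  have hG' : (2 : ℝ) ≤ G := by exact_mod_cast hG
  refine ⟨1 / (8 * (s : ℝ)), by positivity, ?_, ?_⟩
  · apply one_div_lt_one_div_of_lt <;> linarith
  · intro α h0 h1
    have hx : (s : ℝ) * α ≤ 1 / 8 := by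
      rw [le_div_iff₀ (by positivity)] at h1
      linarith
    have hx0 : 0 ≤ (s : ℝ) * α := by positivity
    have hα : α ≤ 1 / 16 := by nlinarith
    have hD : 0 < (s : ℝ) * G - 1 := by nlinarith
    have hd : ((G : ℝ) - 1) / ((s : ℝ) * (G : ℝ) - 1) ≤ 1 / 2 := by
      rw [div_le_div_iff₀ hD (by norm_num)]
      nlinarith
    have hC : (2 - 2 * (s : ℝ) * α) / (1 - 2 * (s : ℝ) * α) ≤ 14 / 5 := by
      rw [div_le_div_iff₀ (by linarith) (by norm_num)]
      linarith
    have hC0 : 0 ≤ (2 - 2 * (s : ℝ) * α) / (1 - 2 * (s : ℝ) * α) :=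
      div_nonneg (by linarith) (by linarith)
    have hR : 2 ≤ (2 - 2 * α) / (1 - 2 * α) := by
      rw [le_div_iff₀ (by linarith)]
      linarith
    calc _ ≤ ((14 : ℝ) / 5) ^ 2 * (1 / 2) := by
          apply mul_le_mul (pow_le_pow_left₀ hC0 hC 2) hd
            (div_nonneg (by linarith) hD.le) (by positivity)
      _ ≤ 2 ^ 2 := by norm_num
      _ ≤ _ := pow_le_pow_left₀ (by norm_num) hR 2
end
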